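/- Let (R,μ) be a non-atomic measure space with 0 < μ(R) < ∞, let A be a Young function, and let 1 ≤ q < p < ∞. Then the continuous embedding L^A ↪ L^{p,q} holds (i.e. there is C > 0 with ‖f‖_{p,q} ≤ C‖f‖_A for all f) if and only if the almost-compact embedding L^A ↪* L^{p,q} holds. -/

import Mathlib

open MeasureTheory Filter Set ENNReal

noncomputable section

/-- A Young function: a convex, non-decreasing, left-continuous function
`A : [0,∞] → [0,∞]` with `A(0) = 0`, `A(0+) = 0` and `A(∞) = ∞`. -/
structure YoungFunction where
  toFun : ℝ≥0∞ → ℝ≥0∞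
  map_zero : toFun 0 = 0
  tendsto_zero : Filter.Tendsto toFun (nhdsWithin 0 (Set.Ioi 0)) (nhds 0)
  mono : Monotone toFun
  convex' : ∀ s t c : ℝ≥0∞, c ≤ 1 →
    toFun (c * s + (1 - c) * t) ≤ c * toFun s + (1 - c) * toFun t
  left_continuous : ∀ t : ℝ≥0∞, 0 < t → toFun t = ⨆ s ∈ Set.Iio t, toFun s
  map_top : toFun ⊤ = ⊤

/-- Left-continuous inverse of a non-decreasing function `F : [0,∞] → [0,∞]`:
`F⁻¹(t) = inf {τ ≥ 0 : F(τ) ≥ t}`. -/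
def leftInvE (F : ℝ≥0∞ → ℝ≥0∞) (t : ℝ≥0∞) : ℝ≥0∞ :=
  sInf {τ : ℝ≥0∞ | t ≤ F τ}

/-- `a` is the right-continuous derivative of the Young function `A`:
`a` is non-decreasing, right-continuous, `a(∞) = ∞`, and
`A(t) = ∫₀ᵗ a(s) ds` for all finite `t ≥ 0`. -/
def IsYoungDerivative (A : YoungFunction) (a : ℝ≥0∞ → ℝ≥0∞) : Prop :=
  Monotone a ∧ a ⊤ = ⊤ ∧
    (∀ t : ℝ≥0∞, t ≠ ⊤ → Filter.Tendsto a (nhdsWithin t (Set.Ioi t)) (nhds (a t))) ∧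
    ∀ t : ℝ, 0 ≤ t →
      A.toFun (ENNReal.ofReal t) = ∫⁻ s in Set.Ioc (0:ℝ) t, a (ENNReal.ofReal s)

/-- The Young conjugate `B̃(t) = sup {s·t − B(s) : s ∈ [0,∞]}`. -/
def youngConj (A : YoungFunction) (t : ℝ≥0∞) : ℝ≥0∞ :=
  ⨆ s : ℝ≥0∞, s * t - A.toFun s

variable {R : Type*} [MeasurableSpace R]

/-- The distribution function `f₊(λ) = μ({x : |f(x)| > λ})`. -/
def distFn (μ : Measure R) (f : R → ℝ) (lam : ℝ≥0∞) : ℝ≥0∞ :=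
  μ {x | lam < ENNReal.ofReal |f x|}

/-- The non-increasing rearrangement `f*(t) = inf {λ ≥ 0 : f₊(λ) ≤ t}`. -/
def rearr (μ : Measure R) (f : R → ℝ) (t : ℝ≥0∞) : ℝ≥0∞ :=
  sInf {lam : ℝ≥0∞ | distFn μ f lam ≤ t}

/-- The Lorentz functional `‖f‖_{p,q}` for `p, q ∈ (0,∞]`. -/
def lorentzNorm (μ : Measure R) (p q : ℝ≥0∞) (f : R → ℝ) : ℝ≥0∞ :=
  if q = ⊤ then
    ⨆ t : Set.Ioi (0:ℝ), ENNReal.ofReal t.1 ^ (p⁻¹).toReal * rearr μ f (ENNReal.ofReal t.1)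
  else
    (∫⁻ t in Set.Ioi (0:ℝ),
        (ENNReal.ofReal t ^ (p⁻¹).toReal * rearr μ f (ENNReal.ofReal t)) ^ q.toReal
          / ENNReal.ofReal t) ^ (q⁻¹).toReal

/-- The Luxemburg norm `‖f‖_A = inf {λ > 0 : ∫ A(|f|/λ) dμ ≤ 1}`. -/
def luxNorm (μ : Measure R) (A : YoungFunction) (f : R → ℝ) : ℝ≥0∞ :=
  sInf {lam : ℝ≥0∞ | 0 < lam ∧ ∫⁻ x, A.toFun (ENNReal.ofReal |f x| / lam) ∂μ ≤ 1}

/-- The measure `μ` is non-atomic: every set of positive measure has a subset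
of strictly smaller positive measure. -/
def NonAtomic (μ : Measure R) : Prop :=
  ∀ s : Set R, MeasurableSet s → 0 < μ s →
    ∃ t, t ⊆ s ∧ MeasurableSet t ∧ 0 < μ t ∧ μ t < μ s

/-- The almost-compact embedding `X ↪* Y`, for (quasi)norm functionals `NX`, `NY`:
`X ⊂ Y` and for every sequence of measurable sets `Eₙ` whose characteristic
functions tend to `0` a.e., `sup_{‖f‖_X ≤ 1} ‖f χ_{Eₙ}‖_Y → 0`. -/
def AlmostCompactEmbedding (μ : Measure R) (NX NY : (R → ℝ) → ℝ≥0∞) : Prop :=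
  (∀ f : R → ℝ, Measurable f → NX f < ⊤ → NY f < ⊤) ∧
    ∀ E : ℕ → Set R, (∀ n, MeasurableSet (E n)) →
      (∀ᵐ x ∂μ, Filter.Tendsto (fun n => (E n).indicator (fun _ => (1:ℝ)) x)
        Filter.atTop (nhds 0)) →
      Filter.Tendsto
        (fun n => ⨆ f : {f : R → ℝ // Measurable f ∧ NX f ≤ 1},
          NY ((E n).indicator f.1)) Filter.atTop (nhds 0)

/-- The continuous embedding `X ↪ Y`: there is `C > 0` with `‖f‖_Y ≤ C ‖f‖_X`. -/
def NormEmbedding (μ : Measure R) (NX NY : (R → ℝ) → ℝ≥0∞) : Prop :=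
  ∃ C : ℝ, 0 < C ∧ ∀ f : R → ℝ, Measurable f → NY f ≤ ENNReal.ofReal C * NX f

lemma NonAtomic.exists_subset_pos_le {μ : Measure R} [IsFiniteMeasure μ] (hna : NonAtomic μ)
    {s : Set R} (hs : MeasurableSet s) (h0 : 0 < μ s) {ε : ℝ≥0∞} (hε : 0 < ε) :
    ∃ t, t ⊆ s ∧ MeasurableSet t ∧ 0 < μ t ∧ μ t ≤ ε := by
  have halving : ∀ n : ℕ, ∃ t, t ⊆ s ∧ MeasurableSet t ∧ 0 < μ t ∧ μ t ≤ μ s * 2⁻¹ ^ n := by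
    intro n
    induction n with
    | zero => exact ⟨s, subset_rfl, hs, h0, by simp⟩
    | succ n ih =>
      obtain ⟨t, hts, htm, ht0, htn⟩ := ih
      obtain ⟨u, hut, hum, hu0, hult⟩ := hna t htm ht0
      have hadd : μ u + μ (t \ u) = μ t := by
        rw [measure_sdiff hut hum.nullMeasurableSet (measure_ne_top μ u)]
        exact add_tsub_cancel_of_le hult.le
      have hbound : μ t * 2⁻¹ ≤ μ s * 2⁻¹ ^ (n + 1) := by
        rw [pow_succ, ← mul_assoc]
        gcongr
      rcases le_or_gt (μ u) (μ t * 2⁻¹) with h | h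
      · exact ⟨u, hut.trans hts, hum, hu0, h.trans hbound⟩
      · refine ⟨t \ u, sdiff_subset.trans hts, htm.diff hum, ?_, le_trans ?_ hbound⟩
        · rw [pos_iff_ne_zero]
          intro hz
          rw [hz, add_zero] at hadd
          exact hult.ne hadd
        · by_contra! h'
          have := ENNReal.add_lt_add h h'
          rw [hadd, ← mul_add, ENNReal.inv_two_add_inv_two, mul_one] at this
          exact this.false
  have hlim : Tendsto (fun n : ℕ => μ s * (2⁻¹ : ℝ≥0∞) ^ n) atTop (nhds 0) := by
    have := ENNReal.Tendsto.const_mul (a := μ s)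
      (ENNReal.tendsto_pow_atTop_nhds_zero_of_lt_one (r := 2⁻¹) (by simp))
      (Or.inr (measure_ne_top μ s))
    simpa using this
  obtain ⟨n, hn⟩ := ((tendsto_order.1 hlim).2 ε hε).exists
  obtain ⟨t, hts, htm, ht0, htn⟩ := halving n
  exact ⟨t, hts, htm, ht0, htn.trans hn.le⟩

/-- Sierpiński's theorem: a finite non-atomic measure takes every intermediate value on
subsets of a given measurable set. -/
lemma NonAtomic.exists_subset_measure_eq {μ : Measure R} [IsFiniteMeasure μ] (hna : NonAtomic μ)
    {s : Set R} (hs : MeasurableSet s) {a : ℝ≥0∞} (ha : a ≤ μ s) :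
    ∃ t, t ⊆ s ∧ MeasurableSet t ∧ μ t = a := by
  let F := {T : Set R // T ⊆ s ∧ MeasurableSet T ∧ μ T ≤ a}
  have hatop : a ≠ ⊤ := ne_top_of_le_ne_top (measure_ne_top μ s) ha
  have step : ∀ (n : ℕ) (T : F), ∃ T' : F, T.1 ⊆ T'.1 ∧
      ∀ U : F, T.1 ⊆ U.1 → μ U.1 ≤ μ T'.1 + ((n : ℝ≥0∞) + 1)⁻¹ := by
    intro n T
    by_contra! h
    let σ := ⨆ U : {U : F // T.1 ⊆ U.1}, μ U.1.1
    have hσ : σ ≤ a := iSup_le fun U => U.1.2.2.2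
    have hlt : σ - ((n : ℝ≥0∞) + 1)⁻¹ < σ := by
      obtain ⟨U, hU, hlt⟩ := h T subset_rfl
      refine ENNReal.sub_lt_self (ne_top_of_le_ne_top hatop hσ) ?_ (by simp)
      have : μ U.1 ≤ σ := le_iSup (fun U : {U : F // T.1 ⊆ U.1} => μ U.1.1) ⟨U, hU⟩
      exact (zero_le.trans_lt (hlt.trans_le this)).ne'
    obtain ⟨⟨T', hT'⟩, hlt'⟩ := lt_iSup_iff.1 hlt
    obtain ⟨U, hU, hltU⟩ := h T' hT'
    have h1 : μ U.1 ≤ σ := le_iSup (fun U : {U : F // T.1 ⊆ U.1} => μ U.1.1) ⟨U, hU⟩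
    exact (hltU.trans_le h1).not_ge (tsub_le_iff_right.1 hlt'.le)
  choose next hnext hmax using step
  let T : ℕ → F := fun n => Nat.rec ⟨∅, empty_subset _, .empty, by simp⟩ next n
  have hmono : Monotone fun n => (T n).1 := monotone_nat_of_le_succ fun n => hnext n (T n)
  have hle : μ (⋃ n, (T n).1) ≤ a := by
    rw [hmono.measure_iUnion]
    exact iSup_le fun n => (T n).2.2.2
  have hsub : (⋃ n, (T n).1) ⊆ s := iUnion_subset fun n => (T n).2.1
  have hmeas : MeasurableSet (⋃ n, (T n).1) := .iUnion fun n => (T n).2.2.1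
  refine ⟨_, hsub, hmeas, hle.antisymm ?_⟩
  by_contra! hlt
  have hdiff : 0 < μ (s \ ⋃ n, (T n).1) := by
    rw [measure_sdiff hsub hmeas.nullMeasurableSet (measure_ne_top μ _)]
    exact tsub_pos_of_lt (hlt.trans_le ha)
  obtain ⟨t, hts, htm, ht0, hta⟩ := hna.exists_subset_pos_le (hs.diff hmeas) hdiff
    (tsub_pos_of_lt hlt)
  have hunion : μ ((⋃ n, (T n).1) ∪ t) = μ (⋃ n, (T n).1) + μ t :=
    measure_union (disjoint_sdiff_right.mono_right hts) htm
  let U : F := ⟨(⋃ n, (T n).1) ∪ t, union_subset hsub (hts.trans sdiff_subset), hmeas.union htm, by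
    rw [hunion]
    calc _ ≤ μ (⋃ n, (T n).1) + (a - μ (⋃ n, (T n).1)) := by gcongr
      _ = a := add_tsub_cancel_of_le hlt.le⟩
  have hUle : ∀ n : ℕ, μ t ≤ ((n : ℝ≥0∞) + 1)⁻¹ := by
    intro n
    have h1 := hmax n (T n) U ((subset_iUnion (fun n => (T n).1) n).trans subset_union_left)
    have h2 : μ (next n (T n)).1 ≤ μ (⋃ n, (T n).1) :=
      measure_mono (subset_iUnion (fun n => (T n).1) (n + 1))
    have h3 : μ (⋃ n, (T n).1) + μ t ≤ μ (⋃ n, (T n).1) + ((n : ℝ≥0∞) + 1)⁻¹ := by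
      rw [← hunion]
      exact h1.trans (by gcongr)
    exact (ENNReal.add_le_add_iff_left (measure_ne_top μ _)).1 h3
  obtain ⟨n, hn⟩ := ENNReal.exists_inv_nat_lt ht0.ne'
  refine ((hUle n).trans ?_).not_gt hn
  exact ENNReal.inv_le_inv.2 le_self_add

/-- A set which is independent of a discrete function and carries the fraction `c` of the mass. -/
lemma NonAtomic.exists_setLIntegral_comp_eq {μ : Measure R} [IsFiniteMeasure μ]
    (hna : NonAtomic μ) {φ : R → ℕ} (hφ : Measurable φ) {c : ℝ≥0∞} (hc : c ≤ 1) :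
    ∃ S, MeasurableSet S ∧ ∀ h : ℕ → ℝ≥0∞,
      ∫⁻ x in S, h (φ x) ∂μ = c * ∫⁻ x, h (φ x) ∂μ := by
  have hpre (n : ℕ) : MeasurableSet (φ ⁻¹' {n}) := hφ (measurableSet_singleton n)
  have (n : ℕ) : ∃ t, t ⊆ φ ⁻¹' {n} ∧ MeasurableSet t ∧ μ t = c * μ (φ ⁻¹' {n}) :=
    hna.exists_subset_measure_eq (hpre n) (mul_le_of_le_one_left zero_le hc)
  choose t hts htm hμt using this
  refine ⟨⋃ n, t n, .iUnion htm, fun h => ?_⟩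
  have hmap : (μ.restrict (⋃ n, t n)).map φ = c • μ.map φ := by
    refine Measure.ext_of_singleton fun n => ?_
    rw [Measure.map_apply hφ (measurableSet_singleton n), Measure.smul_apply,
      Measure.map_apply hφ (measurableSet_singleton n), Measure.restrict_apply (hpre n),
      smul_eq_mul, ← hμt n]
    congr 1
    ext x
    simp only [mem_inter_iff, mem_iUnion]
    constructor
    · rintro ⟨hx, m, hm⟩
      obtain rfl : m = n := (hts m hm).symm.trans hx
      exact hm
    · exact fun hx => ⟨hts n hx, n, hx⟩
  rw [← lintegral_map (measurable_of_countable h) hφ, hmap, lintegral_smul_measure,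
    lintegral_map (measurable_of_countable h) hφ, smul_eq_mul]

lemma distFn_antitone (μ : Measure R) (f : R → ℝ) : Antitone (distFn μ f) :=
  fun _ _ h => measure_mono fun _ hx => lt_of_le_of_lt h hx

lemma rearr_antitone (μ : Measure R) (f : R → ℝ) : Antitone (rearr μ f) :=
  fun _ _ h => sInf_le_sInf fun _ hl => le_trans hl h

/-- The rearrangement is the generalized inverse of the distribution function. -/
lemma lt_rearr_iff {μ : Measure R} {f : R → ℝ} {t lam : ℝ≥0∞} :
    lam < rearr μ f t ↔ t < distFn μ f lam := by
  rw [← not_le, ← not_le, not_iff_not]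
  refine ⟨fun h => ?_, fun h => sInf_le h⟩
  rcases eq_or_ne lam ⊤ with rfl | hlam
  · simp [distFn]
  obtain ⟨u, hu, hulam, hulim⟩ := exists_seq_strictAnti_tendsto' (lt_top_iff_ne_top.2 hlam)
  have hun : distFn μ f lam = ⨆ n, distFn μ f (u n) := by
    have : {x | lam < ENNReal.ofReal |f x|} = ⋃ n, {x | u n < ENNReal.ofReal |f x|} := by
      ext x
      simp only [mem_ofPred_eq, mem_iUnion]
      exact ⟨fun hx => ((tendsto_order.1 hulim).2 _ hx).exists,
        fun ⟨n, hn⟩ => (hulam n).1.trans hn⟩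
    rw [distFn, this, Monotone.measure_iUnion]
    · rfl
    · exact fun m n hmn x hx => lt_of_le_of_lt (hu.antitone hmn) hx
  rw [hun]
  refine iSup_le fun n => ?_
  obtain ⟨l, hl, hlt⟩ := sInf_lt_iff.1 (h.trans_lt (hulam n).1)
  exact (distFn_antitone μ f hlt.le).trans hl

lemma distFn_ne_top (μ : Measure R) [IsFiniteMeasure μ] (f : R → ℝ) (lam : ℝ≥0∞) :
    distFn μ f lam ≠ ⊤ := measure_ne_top _ _

lemma tendsto_distFn_atTop (μ : Measure R) [IsFiniteMeasure μ] {f : R → ℝ} (hf : Measurable f) :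
    Tendsto (fun n : ℕ => distFn μ f n) atTop (nhds 0) := by
  have hm (n : ℕ) : MeasurableSet {x | (n : ℝ≥0∞) < ENNReal.ofReal |f x|} :=
    measurableSet_lt measurable_const (by fun_prop)
  have := tendsto_measure_iInter_atTop (μ := μ) (fun n => (hm n).nullMeasurableSet)
    (fun m n hmn x (hx : (n : ℝ≥0∞) < _) => lt_of_le_of_lt (Nat.cast_le.2 hmn) hx)
    ⟨0, measure_ne_top μ _⟩
  have hempty : ⋂ n : ℕ, {x | (n : ℝ≥0∞) < ENNReal.ofReal |f x|} = ∅ := by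
    ext x
    simp only [mem_iInter, mem_ofPred_eq, mem_empty_iff_false, iff_false, not_forall, not_lt]
    obtain ⟨n, hn⟩ := ENNReal.exists_nat_gt (ofReal_ne_top (r := |f x|))
    exact ⟨n, hn.le⟩
  rwa [hempty, measure_empty] at this

lemma rearr_ne_top (μ : Measure R) [IsFiniteMeasure μ] {f : R → ℝ} (hf : Measurable f)
    {t : ℝ≥0∞} (ht : 0 < t) : rearr μ f t ≠ ⊤ := by
  obtain ⟨n, hn⟩ := ((tendsto_order.1 (tendsto_distFn_atTop μ hf)).2 t ht).exists
  exact ne_top_of_le_ne_top (natCast_ne_top n) (sInf_le hn.le)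

lemma setLIntegral_Ioo_rpow_sub_one {r : ℝ} (hr : 0 < r) {d : ℝ} (hd : 0 ≤ d) :
    ∫⁻ t in Ioo (0 : ℝ) d, ENNReal.ofReal (t ^ (r - 1)) = ENNReal.ofReal (d ^ r / r) := by
  have hint : IntegrableOn (fun t : ℝ => t ^ (r - 1)) (Ioo 0 d) :=
    ((intervalIntegral.intervalIntegrable_rpow' (by linarith)).1).mono_set Ioo_subset_Ioc_self
  rw [← ofReal_integral_eq_lintegral_ofReal hint
    ((ae_restrict_iff' measurableSet_Ioo).2 (.of_forall fun t ht => Real.rpow_nonneg ht.1.le _)),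
    ← integral_Ioc_eq_integral_Ioo, ← intervalIntegral.integral_of_le hd,
    integral_rpow (Or.inl (by linarith))]
  simp [Real.zero_rpow hr.ne']

/-- The Lorentz functional in terms of the distribution function. -/
lemma lorentzNorm_eq_distFn (μ : Measure R) [IsFiniteMeasure μ] {p q : ℝ} (hp : 0 < p)
    (hq : 0 < q) {f : R → ℝ} (hf : Measurable f) :
    lorentzNorm μ (ENNReal.ofReal p) (ENNReal.ofReal q) f =
      (ENNReal.ofReal p * ∫⁻ t in Ioi (0 : ℝ), distFn μ f (ENNReal.ofReal t) ^ (q / p) *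
        ENNReal.ofReal (t ^ (q - 1))) ^ q⁻¹ := by
  have hqp : 0 < q / p := div_pos hq hp
  have hpinv : ((ENNReal.ofReal p)⁻¹).toReal = p⁻¹ := by simp [hp.le]
  have hqinv : ((ENNReal.ofReal q)⁻¹).toReal = q⁻¹ := by simp [hq.le]
  rw [lorentzNorm, if_neg ofReal_ne_top, hpinv, hqinv, toReal_ofReal hq.le]
  congr 1
  let ρ : ℝ → ℝ := fun t => (rearr μ f (ENNReal.ofReal t)).toReal
  have hρm : Measurable ρ :=
    ((rearr_antitone μ f).measurable.comp ENNReal.measurable_ofReal).ennreal_toReal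
  have hwm : Measurable fun t : ℝ => ENNReal.ofReal (t ^ (q / p - 1)) := by fun_prop
  let ν := (volume.restrict (Ioi (0 : ℝ))).withDensity fun t => ENNReal.ofReal (t ^ (q / p - 1))
  have hleft : ∫⁻ t in Ioi (0 : ℝ), (ENNReal.ofReal t ^ p⁻¹ * rearr μ f (ENNReal.ofReal t)) ^ q
      / ENNReal.ofReal t = ∫⁻ t, ENNReal.ofReal (ρ t ^ q) ∂ν := by
    rw [lintegral_withDensity_eq_lintegral_mul _ hwm (by fun_prop)]
    refine setLIntegral_congr_fun measurableSet_Ioi fun t (ht : 0 < t) => ?_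
    have h0 : 0 < ENNReal.ofReal t := ENNReal.ofReal_pos.2 ht
    have hr : rearr μ f (ENNReal.ofReal t) = ENNReal.ofReal (ρ t) :=
      (ofReal_toReal (rearr_ne_top μ hf h0)).symm
    have hρ : 0 ≤ ρ t := toReal_nonneg
    simp only [Pi.mul_apply]
    rw [hr, ENNReal.mul_rpow_of_nonneg _ _ hq.le, ← ENNReal.rpow_mul,
      ENNReal.ofReal_rpow_of_pos ht, ENNReal.ofReal_rpow_of_nonneg hρ hq.le,
      Real.rpow_sub_one ht.ne', ENNReal.ofReal_div_of_pos ht, ENNReal.div_eq_inv_mul,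
      ENNReal.div_eq_inv_mul, mul_assoc, show p⁻¹ * q = q / p by ring]
  have hν {s : ℝ} (hs : 0 < s) : ν {t | s < ρ t} =
      ENNReal.ofReal (p / q) * distFn μ f (ENNReal.ofReal s) ^ (q / p) := by
    have hset : {t | s < ρ t} ∩ Ioi 0 = Ioo 0 (distFn μ f (ENNReal.ofReal s)).toReal := by
      ext t
      rw [mem_inter_iff, mem_ofPred_eq, mem_Ioi, mem_Ioo, and_comm]
      refine and_congr_right fun ht => ?_
      rw [← ENNReal.ofReal_lt_iff_lt_toReal hs.le (rearr_ne_top μ hf (ENNReal.ofReal_pos.2 ht)),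
        lt_rearr_iff, ENNReal.ofReal_lt_iff_lt_toReal ht.le (distFn_ne_top μ f _)]
    have hsm : MeasurableSet {t | s < ρ t} := measurableSet_lt measurable_const hρm
    rw [withDensity_apply _ hsm, Measure.restrict_restrict hsm, hset,
      setLIntegral_Ioo_rpow_sub_one hqp toReal_nonneg, div_eq_inv_mul,
      ENNReal.ofReal_mul (by positivity), ← ENNReal.ofReal_rpow_of_nonneg toReal_nonneg hqp.le,
      ofReal_toReal (distFn_ne_top μ f _), inv_div]
  rw [hleft, lintegral_rpow_eq_lintegral_meas_lt_mul ν (.of_forall fun t => toReal_nonneg)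
    hρm.aemeasurable hq, setLIntegral_congr_fun measurableSet_Ioi fun s (hs : 0 < s) => by
      rw [hν hs, mul_assoc], lintegral_const_mul' _ _ ofReal_ne_top, ← mul_assoc,
    ← ENNReal.ofReal_mul hq.le]
  congr 2
  field_simp

/-- The integral of `f₊(t)^{q/p} t^{q-1}` over `s`; for `s = (0,∞)` it is `‖f‖_{p,q}^q / p`. -/
def distIntegral (μ : Measure R) (p q : ℝ) (f : R → ℝ) (s : Set ℝ) : ℝ≥0∞ :=
  ∫⁻ t in s, distFn μ f (ENNReal.ofReal t) ^ (q / p) * ENNReal.ofReal (t ^ (q - 1))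

lemma lorentzNorm_le_iff {μ : Measure R} [IsFiniteMeasure μ] {p q : ℝ} (hp : 0 < p)
    (hq : 0 < q) {f : R → ℝ} (hf : Measurable f) {c : ℝ≥0∞} :
    lorentzNorm μ (ENNReal.ofReal p) (ENNReal.ofReal q) f ≤ c ↔
      ENNReal.ofReal p * distIntegral μ p q f (Ioi 0) ≤ c ^ q := by
  rw [lorentzNorm_eq_distFn μ hp hq hf, ENNReal.rpow_inv_le_iff hq, distIntegral]

lemma distIntegral_Ioi_zero_le (μ : Measure R) (p q : ℝ) (f : R → ℝ) (M : ℕ) :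
    distIntegral μ p q f (Ioi 0) ≤
      distIntegral μ p q f (Ioc 0 (M : ℝ)) + distIntegral μ p q f (Ioi (M : ℝ)) := by
  rw [← Ioc_union_Ioi_eq_Ioi (Nat.cast_nonneg M)]
  exact lintegral_union_le _ _ _

lemma distIntegral_Ioc_le (μ : Measure R) {p q : ℝ} (hp : 0 < p) (hq : 1 ≤ q) (f : R → ℝ)
    (M : ℕ) :
    distIntegral μ p q f (Ioc 0 (M : ℝ)) ≤
      distFn μ f 0 ^ (q / p) * ENNReal.ofReal ((M : ℝ) ^ (q - 1)) * M := by
  have hqp : 0 ≤ q / p := by positivity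
  calc distIntegral μ p q f (Ioc 0 (M : ℝ))
      ≤ ∫⁻ _ in Ioc (0 : ℝ) M, distFn μ f 0 ^ (q / p) * ENNReal.ofReal ((M : ℝ) ^ (q - 1)) := by
        refine setLIntegral_mono measurable_const fun t ht => ?_
        have h0 : distFn μ f (ENNReal.ofReal t) ≤ distFn μ f 0 := distFn_antitone μ f zero_le
        have h1 : t ^ (q - 1) ≤ (M : ℝ) ^ (q - 1) :=
          Real.rpow_le_rpow ht.1.le ht.2 (by linarith)
        gcongr
    _ = _ := by simp

lemma distIntegral_Ioi_eq_iSup (μ : Measure R) (p q : ℝ) (f : R → ℝ) (M : ℕ) :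
    distIntegral μ p q f (Ioi (M : ℝ)) = ⨆ n : ℕ, distIntegral μ p q f (Ioc (M : ℝ) n) := by
  have hU : Ioi (M : ℝ) = ⋃ n : ℕ, Ioc (M : ℝ) n := by
    ext t
    simp only [mem_Ioi, mem_iUnion, mem_Ioc, exists_and_left]
    exact ⟨fun h => ⟨h, exists_nat_ge t⟩, fun h => h.1⟩
  rw [hU]
  refine setLIntegral_iUnion_of_directed _ (Monotone.directed_le fun m n hmn => ?_)
  exact Ioc_subset_Ioc_right (Nat.cast_le.2 hmn)

lemma distIntegral_Ioi_le_indicator (μ : Measure R) {p q : ℝ} (hp : 0 < p) (hq : 1 ≤ q)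
    (f : R → ℝ) (M : ℕ) :
    distIntegral μ p q f (Ioi (M : ℝ)) ≤
      distIntegral μ p q ({x | (M : ℝ≥0∞) < ENNReal.ofReal |f x|}.indicator f) (Ioi 0) := by
  have hqp : 0 ≤ q / p := by positivity
  refine (lintegral_mono_ae ?_).trans
    (lintegral_mono_set (Ioi_subset_Ioi (Nat.cast_nonneg (α := ℝ) M)))
  filter_upwards [ae_restrict_mem measurableSet_Ioi] with t (ht : (M : ℝ) < t)
  gcongr
  refine measure_mono fun x hx => ?_
  have hMx : (M : ℝ≥0∞) < ENNReal.ofReal |f x| := by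
    refine lt_of_le_of_lt ?_ hx
    rw [← ENNReal.ofReal_natCast]
    exact ENNReal.ofReal_le_ofReal ht.le
  rw [mem_ofPred_eq, indicator_of_mem (show x ∈ {x | (M : ℝ≥0∞) < ENNReal.ofReal |f x|} from hMx)]
  exact hx

lemma lintegral_young_le_one_of_luxNorm_lt {μ : Measure R} {A : YoungFunction} {f : R → ℝ}
    {c : ℝ≥0∞} (h : luxNorm μ A f < c) :
    ∫⁻ x, A.toFun (ENNReal.ofReal |f x| / c) ∂μ ≤ 1 := by
  obtain ⟨l, ⟨_, hl⟩, hlc⟩ := sInf_lt_iff.1 h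
  exact (lintegral_mono fun x => A.mono (ENNReal.div_le_div_left hlc.le _)).trans hl

lemma YoungFunction.measurable (A : YoungFunction) : Measurable A.toFun := A.mono.measurable

lemma YoungFunction.exists_nat_lt (A : YoungFunction) {K : ℝ≥0∞} (hK : K ≠ ⊤) :
    ∃ M : ℕ, K < A.toFun (M / 2) := by
  have h := A.left_continuous ⊤ zero_lt_top
  rw [A.map_top] at h
  obtain ⟨s, hs⟩ := lt_iSup_iff.1 (h ▸ lt_top_iff_ne_top.2 hK)
  obtain ⟨hst, hs⟩ := lt_iSup_iff.1 hs
  obtain ⟨M, hM⟩ := ENNReal.exists_nat_gt (ENNReal.mul_ne_top (ne_of_lt hst) ofNat_ne_top :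
    s * 2 ≠ ⊤)
  refine ⟨M, hs.trans_le (A.mono ?_)⟩
  exact (ENNReal.le_div_iff_mul_le (Or.inl two_ne_zero) (Or.inl ofNat_ne_top)).2 hM.le

/-- Functions in the unit ball of `L^A` have uniformly small distribution at high levels. -/
lemma exists_forall_distFn_le (μ : Measure R) (A : YoungFunction) {ε : ℝ≥0∞} (hε : 0 < ε) :
    ∃ M : ℕ, ∀ f : R → ℝ, Measurable f → luxNorm μ A f ≤ 1 → distFn μ f M ≤ ε := by
  obtain ⟨M, hM⟩ := A.exists_nat_lt (ENNReal.inv_ne_top.2 hε.ne')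
  refine ⟨M, fun f hf hlux => ?_⟩
  have hint := lintegral_young_le_one_of_luxNorm_lt (hlux.trans_lt ENNReal.one_lt_two)
  have hm : Measurable fun x => A.toFun (ENNReal.ofReal |f x| / 2) :=
    A.measurable.comp (by fun_prop)
  have hle : ε⁻¹ * distFn μ f M ≤ 1 := by
    refine le_trans ?_ ((mul_meas_ge_le_lintegral hm ε⁻¹).trans hint)
    refine mul_le_mul_right (measure_mono ?_) _
    intro x (hx : (M : ℝ≥0∞) < ENNReal.ofReal |f x|)
    exact hM.le.trans (A.mono (ENNReal.div_le_div_right hx.le _))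
  have := ENNReal.le_inv_iff_mul_le.2 (mul_comm ε⁻¹ _ ▸ hle)
  rwa [inv_inv] at this

/-- Thinning: a function with values in `ℕ`, of comparable size, whose distribution at levels
`t ≥ 1` and whose modular are those of `f` divided by `N`. -/
lemma NonAtomic.exists_thinning {μ : Measure R} [IsFiniteMeasure μ] (hna : NonAtomic μ)
    (A : YoungFunction) {f : R → ℝ} (hf : Measurable f)
    (hfA : ∫⁻ x, A.toFun (ENNReal.ofReal |f x| / 2) ∂μ ≤ 1) {N : ℕ} (hN : 1 ≤ N) :
    ∃ g : R → ℕ, Measurable g ∧ ∫⁻ x, A.toFun (g x / 4) ∂μ ≤ (N : ℝ≥0∞)⁻¹ ∧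
      ∀ t : ℝ, 1 ≤ t → (N : ℝ≥0∞)⁻¹ * distFn μ f (ENNReal.ofReal t) ≤ μ {x | t < g x} := by
  let φ : R → ℕ := fun x => ⌊|f x|⌋₊
  have hφ : Measurable φ := Nat.measurable_floor.comp (by fun_prop)
  obtain ⟨S, hS, hSint⟩ := hna.exists_setLIntegral_comp_eq hφ
    (ENNReal.inv_le_one.2 (Nat.one_le_cast.2 hN) : (N : ℝ≥0∞)⁻¹ ≤ 1)
  have hg : Measurable (S.indicator fun x => 2 * φ x) := (hφ.const_mul 2).indicator hS
  refine ⟨_, hg, ?_, fun t ht => ?_⟩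
  · have hind (x : R) : A.toFun ((S.indicator (fun x => 2 * φ x) x : ℕ) / 4) =
        S.indicator (fun x => A.toFun ((2 * φ x : ℕ) / 4)) x := by
      by_cases hx : x ∈ S <;> simp [hx, A.map_zero]
    simp_rw [hind]
    rw [lintegral_indicator hS, hSint fun n => A.toFun ((2 * n : ℕ) / 4)]
    refine mul_le_of_le_one_right zero_le (le_trans (lintegral_mono fun x => A.mono ?_) hfA)
    have h4 : (4 : ℝ≥0∞) = 2 * 2 := by norm_num
    rw [Nat.cast_mul, h4, Nat.cast_ofNat, ENNReal.mul_div_mul_left _ _ two_ne_zero ofNat_ne_top]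
    refine ENNReal.div_le_div_right ?_ _
    rw [← ENNReal.ofReal_natCast]
    exact ENNReal.ofReal_le_ofReal (Nat.floor_le (abs_nonneg _))
  · have key := hSint (indicator {n | t < (2 * n : ℕ)} 1)
    have hn : MeasurableSet {x | t < (2 * φ x : ℕ)} := hφ (.of_discrete (s := {n | t < (2 * n : ℕ)}))
    have hcomp : (fun x => indicator {n : ℕ | t < (2 * n : ℕ)} (1 : ℕ → ℝ≥0∞) (φ x)) =
        indicator {x | t < (2 * φ x : ℕ)} 1 := rfl
    rw [hcomp, lintegral_indicator_one hn, lintegral_indicator_one hn,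
      Measure.restrict_apply hn] at key
    calc (N : ℝ≥0∞)⁻¹ * distFn μ f (ENNReal.ofReal t)
        ≤ (N : ℝ≥0∞)⁻¹ * μ {x | t < (2 * φ x : ℕ)} := by
          refine mul_le_mul_right (measure_mono ?_) _
          intro x (hx : ENNReal.ofReal t < ENNReal.ofReal |f x|)
          have hx' : t < |f x| := (ENNReal.ofReal_lt_ofReal_iff_of_nonneg (by linarith)).1 hx
          have h1 : (1 : ℝ) ≤ φ x := by
            exact_mod_cast (Nat.one_le_floor_iff _).2 (ht.trans hx'.le)
          have h2 : |f x| < φ x + 1 := Nat.lt_floor_add_one _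
          show t < (2 * φ x : ℕ)
          push_cast
          linarith
      _ ≤ _ := by
          rw [← key]
          refine measure_mono fun x hx => ?_
          rw [mem_ofPred_eq, indicator_of_mem hx.2]
          exact hx.1

/-- Finitely many functions in the modular ball can be thinned and glued into one. -/
lemma NonAtomic.exists_glued {μ : Measure R} [IsFiniteMeasure μ] (hna : NonAtomic μ)
    (A : YoungFunction) {f : ℕ → R → ℝ} (hf : ∀ k, Measurable (f k))
    (hfA : ∀ k, ∫⁻ x, A.toFun (ENNReal.ofReal |f k x| / 2) ∂μ ≤ 1) {N : ℕ} (hN : 1 ≤ N) :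
    ∃ G : R → ℝ, Measurable G ∧ luxNorm μ A G ≤ 4 ∧ ∀ k < N, ∀ t : ℝ, 1 ≤ t →
      (N : ℝ≥0∞)⁻¹ * distFn μ (f k) (ENNReal.ofReal t) ≤ distFn μ G (ENNReal.ofReal t) := by
  choose g hgm hgA hgd using fun k => hna.exists_thinning A (hf k) (hfA k) hN
  have hne : (Finset.range N).Nonempty := Finset.nonempty_range_iff.2 (by omega)
  let n : R → ℕ := fun x => (Finset.range N).sup' hne fun k => g k x
  have hn : Measurable n := by
    convert Finset.measurable_sup' hne fun k _ => hgm k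
    ext x
    simp [n]
  refine ⟨fun x => n x, measurable_from_top.comp hn, sInf_le ⟨by norm_num, ?_⟩,
    fun k hk t ht => (hgd k t ht).trans (measure_mono fun x (hx : t < g k x) => ?_)⟩
  · have hAg (k : ℕ) : Measurable fun x => A.toFun (g k x / 4) :=
      (measurable_of_countable fun m : ℕ => A.toFun (m / 4)).comp (hgm k)
    calc ∫⁻ x, A.toFun (ENNReal.ofReal |(n x : ℝ)| / 4) ∂μ
        ≤ ∫⁻ x, ∑ k ∈ Finset.range N, A.toFun (g k x / 4) ∂μ := by
          refine lintegral_mono fun x => ?_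
          obtain ⟨k, hk, hkx⟩ := Finset.exists_mem_eq_sup' hne fun k => g k x
          have : n x = g k x := hkx
          simp only [Nat.abs_cast, ENNReal.ofReal_natCast, this]
          exact Finset.single_le_sum (f := fun k => A.toFun (g k x / 4)) (fun _ _ => zero_le) hk
      _ = ∑ k ∈ Finset.range N, ∫⁻ x, A.toFun (g k x / 4) ∂μ :=
          lintegral_finsetSum _ fun k _ => hAg k
      _ ≤ ∑ k ∈ Finset.range N, (N : ℝ≥0∞)⁻¹ := Finset.sum_le_sum fun k _ => hgA k
      _ = 1 := by
          rw [Finset.sum_const, Finset.card_range, nsmul_eq_mul]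
          exact ENNReal.mul_inv_cancel (by simp; omega) (natCast_ne_top N)
  · have hle : g k x ≤ n x := Finset.le_sup' (f := fun k => g k x) (Finset.mem_range.2 hk)
    have : t < n x := hx.trans_le (Nat.cast_le.2 hle)
    rw [mem_ofPred_eq, abs_of_nonneg (Nat.cast_nonneg _)]
    exact (ENNReal.ofReal_lt_ofReal_iff_of_nonneg (by linarith)).2 this

/-- If `L^A ↪ L^{p,q}` with `q < p`, then the tails of the Lorentz integrals over the modular
ball of `L^A` are uniformly small. -/
lemma NormEmbedding.exists_tail_le {μ : Measure R} [IsFiniteMeasure μ] (hna : NonAtomic μ)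
    {A : YoungFunction} {p q : ℝ} (hq : 1 ≤ q) (hqp : q < p)
    (hemb : NormEmbedding μ (luxNorm μ A)
      (lorentzNorm μ (ENNReal.ofReal p) (ENNReal.ofReal q))) {δ : ℝ≥0∞} (hδ : 0 < δ) :
    ∃ M : ℕ, ∀ f : R → ℝ, Measurable f →
      ∫⁻ x, A.toFun (ENNReal.ofReal |f x| / 2) ∂μ ≤ 1 →
      distIntegral μ p q f (Ioi (M : ℝ)) ≤ δ := by
  by_contra! hcon
  have hp : 0 < p := by linarith
  have hqpos : 0 < q := by linarith
  have hqp0 : 0 ≤ q / p := by positivity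
  choose F hFm hFA hFδ using hcon
  have hnext : ∀ M : ℕ, ∃ M' : ℕ, δ < distIntegral μ p q (F M) (Ioc (M : ℝ) M') := by
    intro M
    have := hFδ M
    rw [distIntegral_Ioi_eq_iSup] at this
    exact lt_iSup_iff.1 this
  choose next hnext using hnext
  have hlt (M : ℕ) : M < next M := by
    by_contra! hle
    have := hnext M
    rw [Ioc_eq_empty (by exact_mod_cast hle.not_gt), distIntegral, Measure.restrict_empty,
      lintegral_zero_measure] at this
    exact ENNReal.not_lt_zero this
  let M : ℕ → ℕ := fun k => next^[k] 1
  have hMsucc (k : ℕ) : M (k + 1) = next (M k) := Function.iterate_succ_apply' next k 1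
  have hMmono : Monotone fun k => (M k : ℝ) :=
    monotone_nat_of_le_succ fun k => by rw [hMsucc]; exact_mod_cast (hlt (M k)).le
  have hM1 (k : ℕ) : (1 : ℝ) ≤ M k := by
    simpa [M] using hMmono (Nat.zero_le k)
  obtain ⟨C, hC, hemb⟩ := hemb
  let K : ℝ≥0∞ := (ENNReal.ofReal C * 4) ^ q
  have hK : K ≠ ⊤ := ENNReal.rpow_ne_top_of_nonneg hqpos.le
    (ENNReal.mul_ne_top ofReal_ne_top ofNat_ne_top)
  have hbound : ∀ N : ℕ, 1 ≤ N →
      ENNReal.ofReal p * δ * (N : ℝ≥0∞) ^ (1 - q / p) ≤ K := by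
    intro N hN
    have hN0 : (N : ℝ≥0∞) ≠ 0 := by simp; omega
    obtain ⟨G, hGm, hGA, hG⟩ := hna.exists_glued A (fun k => hFm (M k)) (fun k => hFA (M k)) hN
    have hGle : ENNReal.ofReal p * distIntegral μ p q G (Ioi 0) ≤ K :=
      (lorentzNorm_le_iff hp hqpos hGm).1 ((hemb G hGm).trans (by gcongr))
    have hpiece : ∀ k ∈ Finset.range N, (N : ℝ≥0∞)⁻¹ ^ (q / p) * δ ≤
        distIntegral μ p q G (Ioc (M k : ℝ) (M (k + 1))) := by
      intro k hk
      have hc : (N : ℝ≥0∞)⁻¹ ^ (q / p) ≠ ⊤ :=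
        ENNReal.rpow_ne_top_of_nonneg hqp0 (ENNReal.inv_ne_top.2 hN0)
      calc (N : ℝ≥0∞)⁻¹ ^ (q / p) * δ
          ≤ (N : ℝ≥0∞)⁻¹ ^ (q / p) *
              distIntegral μ p q (F (M k)) (Ioc (M k : ℝ) (M (k + 1))) := by
            rw [hMsucc]
            exact mul_le_mul_right (hnext (M k)).le _
        _ = ∫⁻ t in Ioc (M k : ℝ) (M (k + 1)),
              ((N : ℝ≥0∞)⁻¹ * distFn μ (F (M k)) (ENNReal.ofReal t)) ^ (q / p) *
                ENNReal.ofReal (t ^ (q - 1)) := by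
            rw [distIntegral, ← lintegral_const_mul' _ _ hc]
            simp_rw [ENNReal.mul_rpow_of_nonneg _ _ hqp0, mul_assoc]
        _ ≤ _ := by
            refine lintegral_mono_ae ?_
            filter_upwards [ae_restrict_mem measurableSet_Ioc] with t ht
            have := hG k (Finset.mem_range.1 hk) t ((hM1 k).trans ht.1.le)
            gcongr
    have hdisj : Set.PairwiseDisjoint (Finset.range N : Set ℕ)
        fun k => Ioc (M k : ℝ) (M (k + 1)) := fun i _ j _ hij =>
      hMmono.pairwise_disjoint_on_Ioc_succ hij
    have hsum : N * ((N : ℝ≥0∞)⁻¹ ^ (q / p) * δ) ≤ distIntegral μ p q G (Ioi 0) := by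
      calc N * ((N : ℝ≥0∞)⁻¹ ^ (q / p) * δ)
          = ∑ k ∈ Finset.range N, (N : ℝ≥0∞)⁻¹ ^ (q / p) * δ := by simp
        _ ≤ ∑ k ∈ Finset.range N, distIntegral μ p q G (Ioc (M k : ℝ) (M (k + 1))) :=
            Finset.sum_le_sum hpiece
        _ = distIntegral μ p q G (⋃ k ∈ Finset.range N, Ioc (M k : ℝ) (M (k + 1))) :=
            (lintegral_biUnion_finset hdisj (fun _ _ => measurableSet_Ioc) _).symm
        _ ≤ _ := lintegral_mono_set (iUnion₂_subset fun k _ t ht =>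
            (zero_lt_one.trans_le (hM1 k)).trans ht.1)
    calc ENNReal.ofReal p * δ * (N : ℝ≥0∞) ^ (1 - q / p)
        = ENNReal.ofReal p * (N * ((N : ℝ≥0∞)⁻¹ ^ (q / p) * δ)) := by
          rw [ENNReal.rpow_sub _ _ hN0 (natCast_ne_top N), ENNReal.rpow_one, ENNReal.inv_rpow,
            div_eq_mul_inv]
          ring
      _ ≤ K := (by gcongr : _ ≤ _).trans hGle
  have hr : 0 < 1 - q / p := by rw [sub_pos, div_lt_one hp]; exact hqp
  have hpδ : ENNReal.ofReal p * δ ≠ 0 := mul_ne_zero (ENNReal.ofReal_pos.2 hp).ne' hδ.ne'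
  have hKδ : (K / (ENNReal.ofReal p * δ)) ^ (1 - q / p)⁻¹ ≠ ⊤ :=
    ENNReal.rpow_ne_top_of_nonneg (inv_nonneg.2 hr.le) (ENNReal.div_ne_top hK hpδ)
  obtain ⟨N, hN⟩ := ENNReal.exists_nat_gt hKδ
  have hN1 : 1 ≤ N := by
    have : (0 : ℝ≥0∞) < N := lt_of_le_of_lt zero_le hN
    exact_mod_cast this
  refine hN.not_ge ?_
  rw [ENNReal.le_rpow_inv_iff hr, ENNReal.le_div_iff_mul_le (Or.inl hpδ) (Or.inr hK), mul_comm]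
  exact hbound N hN1

/-- For `q < p`, the continuous embedding of an Orlicz space into `L^{p,q}` is almost compact. -/
lemma NormEmbedding.almostCompactEmbedding {μ : Measure R} [IsFiniteMeasure μ]
    (hna : NonAtomic μ) {A : YoungFunction} {p q : ℝ} (hq : 1 ≤ q) (hqp : q < p)
    (hemb : NormEmbedding μ (luxNorm μ A)
      (lorentzNorm μ (ENNReal.ofReal p) (ENNReal.ofReal q))) :
    AlmostCompactEmbedding μ (luxNorm μ A)
      (lorentzNorm μ (ENNReal.ofReal p) (ENNReal.ofReal q)) := by
  have hp : 0 < p := by linarith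
  have hqpos : 0 < q := by linarith
  have hqp0 : 0 < q / p := by positivity
  refine ⟨fun f hf hfA => ?_, fun E hE hlim => ?_⟩
  · obtain ⟨C, hC, h⟩ := hemb
    exact (h f hf).trans_lt (ENNReal.mul_lt_top ofReal_lt_top hfA)
  rw [ENNReal.tendsto_nhds_zero]
  intro ε hε
  let δ : ℝ≥0∞ := ε ^ q / ENNReal.ofReal p / 2
  have hδ : 0 < δ := ENNReal.div_pos
    (ENNReal.div_pos (ENNReal.rpow_pos_of_nonneg hε hqpos.le).ne' ofReal_ne_top).ne' ofNat_ne_top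
  have hδε : ENNReal.ofReal p * (δ + δ) ≤ ε ^ q := by
    rw [ENNReal.add_halves]
    exact ENNReal.mul_div_le
  obtain ⟨M, hM⟩ := hemb.exists_tail_le hna hq hqp hδ
  have hμE : Tendsto (fun n => μ (E n)) atTop (nhds 0) := by
    have := tendsto_measure_of_ae_tendsto_indicator_of_isFiniteMeasure (μ := μ) (A := ∅) atTop
      MeasurableSet.empty hE ?_
    · simpa using this
    · filter_upwards [hlim] with x hx
      have hx' := hx.eventually_lt_const (u := 1) zero_lt_one
      filter_upwards [hx'] with n hn
      simp only [mem_empty_iff_false, iff_false]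
      intro hxn
      simp [hxn] at hn
  have hsmall : ∀ᶠ n in atTop,
      μ (E n) ^ (q / p) * ENNReal.ofReal ((M : ℝ) ^ (q - 1)) * M ≤ δ := by
    have h1 : Tendsto (fun n => μ (E n) ^ (q / p) * (ENNReal.ofReal ((M : ℝ) ^ (q - 1)) * M))
        atTop (nhds (0 ^ (q / p) * (ENNReal.ofReal ((M : ℝ) ^ (q - 1)) * M))) :=
      ENNReal.Tendsto.mul_const ((ENNReal.continuous_rpow_const.tendsto 0).comp hμE)
        (Or.inr (ENNReal.mul_ne_top ofReal_ne_top (natCast_ne_top M)))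
    rw [ENNReal.zero_rpow_of_pos hqp0, zero_mul] at h1
    simpa only [mul_assoc] using (ENNReal.tendsto_nhds_zero.1 h1) δ hδ
  filter_upwards [hsmall] with n hn
  refine iSup_le fun ⟨f, hf, hfA⟩ => ?_
  have hfE : Measurable ((E n).indicator f) := hf.indicator (hE n)
  refine (lorentzNorm_le_iff hp hqpos hfE).2 (le_trans ?_ hδε)
  gcongr
  refine (distIntegral_Ioi_zero_le μ p q _ M).trans (add_le_add ?_ (hM _ hfE ?_))
  · refine (distIntegral_Ioc_le μ hp hq _ M).trans (le_trans ?_ hn)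
    have : distFn μ ((E n).indicator f) 0 ≤ μ (E n) := by
      refine measure_mono fun x hx => ?_
      by_contra hxn
      simp [hxn] at hx
    gcongr
  · refine le_trans (lintegral_mono fun x => A.mono (ENNReal.div_le_div_right ?_ _))
      (lintegral_young_le_one_of_luxNorm_lt (hfA.trans_lt ENNReal.one_lt_two))
    by_cases hx : x ∈ E n <;> simp [hx]

lemma lorentzNorm_le_mul_lorentzNorm_div (μ : Measure R) {p q : ℝ} (hq : 0 < q)
    (f : R → ℝ) {r : ℝ} (hr : 0 < r) :
    lorentzNorm μ (ENNReal.ofReal p) (ENNReal.ofReal q) f ≤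
      ENNReal.ofReal r *
        lorentzNorm μ (ENNReal.ofReal p) (ENNReal.ofReal q) fun x => f x / r := by
  have hr0 : ENNReal.ofReal r ≠ 0 := (ENNReal.ofReal_pos.2 hr).ne'
  have hdist (l : ℝ≥0∞) : distFn μ f (ENNReal.ofReal r * l) = distFn μ (fun x => f x / r) l := by
    simp only [distFn, abs_div, abs_of_pos hr, ENNReal.ofReal_div_of_pos hr,
      ENNReal.lt_div_iff_mul_lt (Or.inl hr0) (Or.inl ofReal_ne_top), mul_comm]
  have hrearr (t : ℝ≥0∞) : rearr μ f t ≤ ENNReal.ofReal r * rearr μ (fun x => f x / r) t := by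
    by_contra! h
    rw [lt_rearr_iff, hdist, ← lt_rearr_iff] at h
    exact h.false
  have hqt : 0 ≤ (ENNReal.ofReal q).toReal := toReal_nonneg
  have hqinv : 0 ≤ ((ENNReal.ofReal q)⁻¹).toReal := toReal_nonneg
  have hqq : (ENNReal.ofReal q).toReal * ((ENNReal.ofReal q)⁻¹).toReal = 1 := by
    simp [hq.le, hq.ne']
  simp only [lorentzNorm, if_neg ofReal_ne_top]
  rw [← ENNReal.rpow_one (ENNReal.ofReal r), ← hqq, ENNReal.rpow_mul,
    ← ENNReal.mul_rpow_of_nonneg _ _ hqinv,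
    ← lintegral_const_mul' _ _ (ENNReal.rpow_ne_top_of_nonneg hqt ofReal_ne_top)]
  refine ENNReal.rpow_le_rpow (lintegral_mono fun t => ?_) hqinv
  simp only
  rw [← mul_div_assoc, ← ENNReal.mul_rpow_of_nonneg _ _ hqt, mul_left_comm]
  gcongr
  exact hrearr _

/-- The continuity estimate follows from a bound on the unit ball by homogeneity. -/
lemma normEmbedding_of_bounded {μ : Measure R} {A : YoungFunction} {p q : ℝ} (hq : 0 < q)
    {C : ℝ} (hC : 0 < C) (h : ∀ f : R → ℝ, Measurable f → luxNorm μ A f ≤ 1 →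
      lorentzNorm μ (ENNReal.ofReal p) (ENNReal.ofReal q) f ≤ ENNReal.ofReal C) :
    NormEmbedding μ (luxNorm μ A)
      (lorentzNorm μ (ENNReal.ofReal p) (ENNReal.ofReal q)) := by
  refine ⟨C, hC, fun f hf => ?_⟩
  have hC0 : ENNReal.ofReal C ≠ 0 := (ENNReal.ofReal_pos.2 hC).ne'
  rw [← ENNReal.div_le_iff' hC0 ofReal_ne_top]
  refine le_sInf fun l ⟨hl, hint⟩ => ?_
  rcases eq_or_ne l ⊤ with rfl | hltop
  · exact le_top
  rw [ENNReal.div_le_iff' hC0 ofReal_ne_top]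
  have hr : 0 < l.toReal := toReal_pos hl.ne' hltop
  have hlr : ENNReal.ofReal l.toReal = l := ofReal_toReal hltop
  have hunit : luxNorm μ A (fun x => f x / l.toReal) ≤ 1 := by
    refine sInf_le ⟨zero_lt_one, ?_⟩
    simpa only [abs_div, abs_of_pos hr, ENNReal.ofReal_div_of_pos hr, hlr, div_one] using hint
  calc _ ≤ _ := lorentzNorm_le_mul_lorentzNorm_div μ hq f hr
    _ ≤ l * ENNReal.ofReal C := by
      rw [hlr]
      gcongr
      exact h _ (hf.div_const _) hunit
    _ = _ := mul_comm _ _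

lemma AlmostCompactEmbedding.normEmbedding {μ : Measure R} [IsFiniteMeasure μ]
    {A : YoungFunction} {p q : ℝ} (hp : 0 < p) (hq : 1 ≤ q)
    (hac : AlmostCompactEmbedding μ (luxNorm μ A)
      (lorentzNorm μ (ENNReal.ofReal p) (ENNReal.ofReal q))) :
    NormEmbedding μ (luxNorm μ A)
      (lorentzNorm μ (ENNReal.ofReal p) (ENNReal.ofReal q)) := by
  have hqpos : 0 < q := by linarith
  have hqp0 : 0 < q / p := by positivity
  have hp0 : 0 < ENNReal.ofReal p := ENNReal.ofReal_pos.2 hp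
  by_contra hcon
  have hlarge : ∀ K : ℝ≥0∞, K ≠ ⊤ → ∃ f : R → ℝ, Measurable f ∧ luxNorm μ A f ≤ 1 ∧
      K < distIntegral μ p q f (Ioi 0) := by
    intro K hK
    by_contra! hle
    have hctop : (ENNReal.ofReal p * K) ^ q⁻¹ ≠ ⊤ :=
      ENNReal.rpow_ne_top_of_nonneg (by positivity) (ENNReal.mul_ne_top ofReal_ne_top hK)
    refine hcon (normEmbedding_of_bounded hqpos
      (C := ((ENNReal.ofReal p * K) ^ q⁻¹).toReal + 1) (by positivity) fun f hf hfA => ?_)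
    have hc : (ENNReal.ofReal p * K) ^ q⁻¹ ≤
        ENNReal.ofReal (((ENNReal.ofReal p * K) ^ q⁻¹).toReal + 1) := by
      conv_lhs => rw [← ofReal_toReal hctop]
      exact ENNReal.ofReal_le_ofReal (by linarith)
    refine le_trans ((lorentzNorm_le_iff hp hqpos hf).2 ?_) hc
    rw [ENNReal.rpow_inv_rpow hqpos.ne']
    gcongr
    exact hle f hf hfA
  choose M hM using fun n : ℕ =>
    exists_forall_distFn_le μ A (ε := 2⁻¹ ^ n) (ENNReal.pow_pos (by simp) n)
  let B : ℕ → ℝ≥0∞ := fun n => μ univ ^ (q / p) * ENNReal.ofReal ((M n : ℝ) ^ (q - 1)) * M n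
  have hB (n : ℕ) : B n ≠ ⊤ := ENNReal.mul_ne_top (ENNReal.mul_ne_top
    (ENNReal.rpow_ne_top_of_nonneg hqp0.le (measure_ne_top μ _)) ofReal_ne_top) (natCast_ne_top _)
  choose f hfm hfA hfB using fun n => hlarge (B n + 1) (ENNReal.add_ne_top.2 ⟨hB n, one_ne_top⟩)
  let E : ℕ → Set R := fun n => {x | (M n : ℝ≥0∞) < ENNReal.ofReal |f n x|}
  have hE (n : ℕ) : MeasurableSet (E n) :=
    measurableSet_lt measurable_const (by have := hfm n; fun_prop)
  have hEsum : ∑' n, μ (E n) ≠ ⊤ := by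
    refine ne_top_of_le_ne_top ?_ (ENNReal.tsum_le_tsum fun n => hM n (f n) (hfm n) (hfA n))
    rw [ENNReal.tsum_geometric]
    simp
  have hElim : ∀ᵐ x ∂μ, Tendsto (fun n => (E n).indicator (fun _ => (1 : ℝ)) x) atTop
      (nhds 0) := by
    filter_upwards [ae_eventually_notMem hEsum] with x hx
    refine tendsto_const_nhds.congr' ?_
    filter_upwards [hx] with n hn
    simp [hn]
  have hεpos : 0 < ENNReal.ofReal p ^ q⁻¹ := ENNReal.rpow_pos hp0 ofReal_ne_top
  obtain ⟨n, hn⟩ := (ENNReal.tendsto_nhds_zero.1 (hac.2 E hE hElim) _ hεpos).exists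
  have hle := (le_iSup (fun g : {g : R → ℝ // Measurable g ∧ luxNorm μ A g ≤ 1} =>
    lorentzNorm μ (ENNReal.ofReal p) (ENNReal.ofReal q) ((E n).indicator g.1))
    ⟨f n, hfm n, hfA n⟩).trans hn
  rw [lorentzNorm_le_iff hp hqpos ((hfm n).indicator (hE n)), ENNReal.rpow_inv_rpow hqpos.ne'] at hle
  have hone : distIntegral μ p q ((E n).indicator (f n)) (Ioi 0) ≤ 1 := by
    refine (ENNReal.mul_le_mul_iff_right hp0.ne' ofReal_ne_top).1 ?_
    rwa [mul_one]
  refine (hfB n).not_ge ((distIntegral_Ioi_zero_le μ p q (f n) (M n)).trans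
    (add_le_add ?_ ((distIntegral_Ioi_le_indicator μ hp hq (f n) (M n)).trans hone)))
  refine (distIntegral_Ioc_le μ hp hq (f n) (M n)).trans ?_
  have : distFn μ (f n) 0 ≤ μ univ := measure_mono (subset_univ _)
  simp only [B]
  gcongr

/-- On a non-atomic finite measure space of positive measure,
for a Young function `A` and `1 ≤ q < p < ∞`, the continuous embedding
`L^A ↪ L^{p,q}` holds iff the almost-compact embedding `L^A ↪* L^{p,q}` holds. -/
theorem orlicz_lorentz_embedding_iff_almost_compact
    {R : Type*} [MeasurableSpace R] (μ : Measure R)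
    (hna : NonAtomic μ) (hpos : 0 < μ Set.univ) (hfin : μ Set.univ < ⊤)
    (A : YoungFunction) (p q : ℝ) (hq : 1 ≤ q) (hqp : q < p) :
    NormEmbedding μ (luxNorm μ A)
        (lorentzNorm μ (ENNReal.ofReal p) (ENNReal.ofReal q)) ↔
      AlmostCompactEmbedding μ (luxNorm μ A)
        (lorentzNorm μ (ENNReal.ofReal p) (ENNReal.ofReal q)) := by
  have : IsFiniteMeasure μ := ⟨hfin⟩
  exact ⟨fun h => h.almostCompactEmbedding hna hq hqp,
    fun h => h.normEmbedding (by linarith) hq⟩
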